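/- Let X = |0⟩⟨1| + |1⟩⟨0| and Z = |0⟩⟨0| − |1⟩⟨1| be the Pauli matrices and fix q ∈ [0,1]. Then the mixed-unitary channel Λ_mixed(ρ) = q·XρX† + (1−q)·ZρZ† is an incoherent operation induced by C_{E,r}: for every 2×2 density matrix ρ, C_{E,r}(q·XρX† + (1−q)·ZρZ†) ≤ C_{E,r}(ρ). -/

import Mathlib

open Matrix ComplexOrder

/-- The POVM vectors `|φ_k⟩ = (|0⟩ + i^k |1⟩)/√2` for `k = 0,1,2,3`. -/
noncomputable def phiv (k : Fin 4) : Fin 2 → ℂ :=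
  ![(1 : ℂ) / Real.sqrt 2, Complex.I ^ (k : ℕ) / Real.sqrt 2]

/-- The outer product `|ψ⟩⟨ψ|`. -/
def outer (ψ : Fin 2 → ℂ) : Matrix (Fin 2) (Fin 2) ℂ :=
  vecMulVec ψ (star ψ)

/-- The POVM outcome probabilities `p_k(ρ) = (1/2)⟨φ_k|ρ|φ_k⟩`. -/
noncomputable def pk (ρ : Matrix (Fin 2) (Fin 2) ℂ) (k : Fin 4) : ℝ :=
  (star (phiv k) ⬝ᵥ ρ.mulVec (phiv k)).re / 2

/-- `-x log₂ x`, with the convention `0 log₂ 0 = 0`. -/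
noncomputable def ent2 (x : ℝ) : ℝ := -(x * Real.logb 2 x)

/-- The Shannon entropy (base 2) of the POVM outcome distribution of `ρ`. -/
noncomputable def H4 (ρ : Matrix (Fin 2) (Fin 2) ℂ) : ℝ := ∑ k : Fin 4, ent2 (pk ρ k)

/-- The binary entropy `h(λ)` (base 2). -/
noncomputable def binEnt (l : ℝ) : ℝ := ent2 l + ent2 (1 - l)

/-- A qubit density matrix: positive semidefinite with trace 1. -/
def IsDensity2 (ρ : Matrix (Fin 2) (Fin 2) ℂ) : Prop :=
  ρ.PosSemidef ∧ ρ.trace = 1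

/-- The von Neumann entropy (base 2) of a qubit density matrix `ρ`, expressed through its
eigenvalues `μ, 1-μ`, where `μ = (1 + √(1 - 4 det ρ))/2`. -/
noncomputable def Sent (ρ : Matrix (Fin 2) (Fin 2) ℂ) : ℝ :=
  binEnt ((1 + Real.sqrt (1 - 4 * (ρ.det).re)) / 2)

/-- The Pauli X matrix. -/
def Xg : Matrix (Fin 2) (Fin 2) ℂ := !![0, 1; 1, 0]

/-- The Pauli Z matrix. -/
def Zg : Matrix (Fin 2) (Fin 2) ℂ := !![1, 0; 0, -1]

/-- The binary entropy (in nats) of a qubit, as a function of its squared Bloch radius. -/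
noncomputable def blochEntropy (s : ℝ) : ℝ := Real.binEntropy ((1 + √s) / 2)

lemma blochEntropy_sq (x : ℝ) : blochEntropy (x ^ 2) = Real.binEntropy ((1 + x) / 2) := by
  unfold blochEntropy
  rw [Real.sqrt_sq_eq_abs]
  rcases abs_choice x with h | h <;> rw [h]
  rw [← Real.binEntropy_one_sub]
  ring_nf

lemma log_one_add_sub_log_one_sub_div_le {s t : ℝ} (hs : 0 < s) (hst : s ≤ t) (ht : t < 1) :
    (Real.log (1 + s) - Real.log (1 - s)) / s ≤ (Real.log (1 + t) - Real.log (1 - t)) / t := by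
  have h₁ := (Real.hasSum_log_sub_log_of_abs_lt_one (x := s)
    (abs_lt.2 ⟨by linarith, by linarith⟩)).div_const s
  have h₂ := (Real.hasSum_log_sub_log_of_abs_lt_one (x := t)
    (abs_lt.2 ⟨by linarith, by linarith⟩)).div_const t
  refine hasSum_le (fun k => ?_) h₁ h₂
  have e : ∀ r : ℝ, 0 < r → 2 * (1 / (2 * (k : ℝ) + 1)) * r ^ (2 * k + 1) / r
      = 2 * (1 / (2 * (k : ℝ) + 1)) * r ^ (2 * k) := by
    intro r hr
    field_simp
    ring
  rw [e s hs, e t (hs.trans_le hst)]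
  gcongr

lemma hasDerivAt_blochEntropy {s : ℝ} (h₀ : 0 < s) (h₁ : s < 1) :
    HasDerivAt blochEntropy
      (-((Real.log (1 + √s) - Real.log (1 - √s)) / √s) / 4) s := by
  have hr₀ : 0 < √s := Real.sqrt_pos.2 h₀
  have hr₁ : √s < 1 := by rw [Real.sqrt_lt' one_pos]; simpa using h₁
  have hd := (((Real.hasDerivAt_sqrt h₀.ne').const_add 1).div_const 2)
  have hb := Real.hasDerivAt_binEntropy (p := (1 + √s) / 2) (by positivity) (by linarith)
  refine (hb.comp s hd).congr_deriv ?_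
  rw [show 1 - (1 + √s) / 2 = (1 - √s) / 2 by ring,
    Real.log_div (by linarith) two_ne_zero, Real.log_div (by linarith) two_ne_zero]
  field_simp
  ring

lemma concaveOn_blochEntropy : ConcaveOn ℝ (Set.Icc 0 1) blochEntropy := by
  refine AntitoneOn.concaveOn_of_deriv (convex_Icc 0 1) ?_ ?_ ?_
  · unfold blochEntropy
    fun_prop
  · rw [interior_Icc]
    exact fun s hs => (hasDerivAt_blochEntropy hs.1 hs.2).differentiableAt.differentiableWithinAt
  · rw [interior_Icc]
    intro s hs t ht hst
    rw [(hasDerivAt_blochEntropy hs.1 hs.2).deriv, (hasDerivAt_blochEntropy ht.1 ht.2).deriv]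
    have := log_one_add_sub_log_one_sub_div_le (Real.sqrt_pos.2 hs.1) (Real.sqrt_le_sqrt hst)
      (by rw [Real.sqrt_lt' one_pos]; simpa using ht.2)
    linarith

lemma antitoneOn_blochEntropy : AntitoneOn blochEntropy (Set.Icc 0 1) := by
  intro s hs t ht hst
  have key : ∀ r ∈ Set.Icc (0 : ℝ) 1, (1 + √r) / 2 ∈ Set.Icc (2⁻¹ : ℝ) 1 := by
    intro r hr
    have h₀ := Real.sqrt_nonneg r
    have h₁ := Real.sqrt_le_one.2 hr.2
    constructor <;> linarith
  refine Real.binEntropy_strictAntiOn.antitoneOn (key s hs) (key t ht) ?_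
  have := Real.sqrt_le_sqrt hst
  linarith

/-- The increments of a concave function over intervals of equal length decrease. -/
lemma ConcaveOn.sub_le_sub_of_add {S : Set ℝ} {f : ℝ → ℝ} (hf : ConcaveOn ℝ S f) {a b d : ℝ}
    (ha : a ∈ S) (hb : b + d ∈ S) (hab : a ≤ b) (hd : 0 ≤ d) :
    f a - f (a + d) ≤ f b - f (b + d) := by
  rcases (add_nonneg (sub_nonneg.2 hab) hd).eq_or_lt with h | h
  · obtain rfl : a = b := by linarith
    rfl
  have h₁ := hf.2 ha hb
    (div_nonneg (sub_nonneg.2 hab) h.le) (div_nonneg hd h.le) (by field_simp)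
  have h₂ := hf.2 ha hb
    (div_nonneg hd h.le) (div_nonneg (sub_nonneg.2 hab) h.le) (by field_simp; ring)
  have e₁ : ((b - a) / (b - a + d)) • a + (d / (b - a + d)) • (b + d) = a + d := by
    simp only [smul_eq_mul]
    field_simp
    ring
  have e₂ : (d / (b - a + d)) • a + ((b - a) / (b - a + d)) • (b + d) = b := by
    simp only [smul_eq_mul]
    field_simp
    ring
  rw [e₁] at h₁
  rw [e₂] at h₂
  have e : (b - a) / (b - a + d) + d / (b - a + d) = 1 := by field_simp
  simp only [smul_eq_mul] at h₁ h₂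
  linear_combination h₁ + h₂ + (- f a - f (b + d)) * e

lemma ent2_half (w : ℝ) : ent2 (w / 2) = ent2 w / 2 + w / 2 := by
  unfold ent2
  rcases eq_or_ne w 0 with rfl | hw
  · simp
  rw [Real.logb_div hw two_ne_zero, Real.logb_self_eq_one one_lt_two]
  ring

lemma binEnt_eq (w : ℝ) : binEnt w = Real.binEntropy w / Real.log 2 := by
  unfold binEnt ent2
  rw [Real.binEntropy_eq_negMulLog_add_negMulLog_one_sub]
  simp only [Real.negMulLog, Real.logb]
  ring

lemma ent2_add_ent2 (x : ℝ) :
    ent2 ((1 + x) / 4) + ent2 ((1 - x) / 4) = blochEntropy (x ^ 2) / Real.log 2 / 2 + 1 / 2 := by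
  rw [blochEntropy_sq, ← binEnt_eq, binEnt, show (1 + x) / 4 = (1 + x) / 2 / 2 by ring,
    show (1 - x) / 4 = (1 - (1 + x) / 2) / 2 by ring, ent2_half ((1 + x) / 2),
    ent2_half (1 - (1 + x) / 2)]
  ring

/-- The Hermitian trace-one matrix with upper-left entry `p` and upper-right entry `b + c i`. -/
noncomputable def qubit (p b c : ℝ) : Matrix (Fin 2) (Fin 2) ℂ :=
  !![(p : ℂ), b + c * Complex.I; b - c * Complex.I, 1 - p]

lemma IsDensity2.exists_eq_qubit {ρ : Matrix (Fin 2) (Fin 2) ℂ} (hρ : IsDensity2 ρ) :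
    ∃ p b c : ℝ, ρ = qubit p b c := by
  obtain ⟨hpos, htr⟩ := hρ
  have h := hpos.isHermitian
  refine ⟨(ρ 0 0).re, (ρ 0 1).re, (ρ 0 1).im, ?_⟩
  have h00 : ((ρ 0 0).re : ℂ) = ρ 0 0 := Complex.conj_eq_iff_re.1 (h.apply 0 0)
  have h10 : star (ρ 0 1) = ρ 1 0 := h.apply 1 0
  rw [Matrix.trace_fin_two] at htr
  ext i j
  fin_cases i <;> fin_cases j
  · simp [qubit, h00]
  · simp [qubit]
  · simp only [qubit]
    simp [← h10, Complex.ext_iff]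
  · simp [qubit, h00, ← htr]

lemma det_qubit (p b c : ℝ) :
    (qubit p b c).det = ((p * (1 - p) - b ^ 2 - c ^ 2 : ℝ) : ℂ) := by
  rw [qubit, Matrix.det_fin_two_of]
  push_cast
  linear_combination (c : ℂ) ^ 2 * Complex.I_sq

lemma Sent_qubit (p b c : ℝ) : Sent (qubit p b c) =
    blochEntropy ((2 * p - 1) ^ 2 + (2 * b) ^ 2 + (2 * c) ^ 2) / Real.log 2 := by
  rw [Sent, binEnt_eq, blochEntropy, det_qubit, Complex.ofReal_re]
  ring_nf

lemma pk_qubit (p b c : ℝ) (k : Fin 4) :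
    pk (qubit p b c) k = (1 + 2 * (Complex.I ^ (k : ℕ) * (b + c * Complex.I)).re) / 4 := by
  have h2 : (√2)⁻¹ * (√2)⁻¹ = (1 / 2 : ℝ) := by
    rw [← mul_inv, Real.mul_self_sqrt zero_le_two, one_div]
  fin_cases k <;>
    simp [pk, phiv, qubit, dotProduct, Matrix.mulVec, Fin.sum_univ_two, div_eq_mul_inv, pow_succ,
      ← Complex.ofReal_inv] <;>
    ring_nf at h2 ⊢ <;> rw [h2] <;> ring

lemma H4_qubit (p b c : ℝ) : H4 (qubit p b c) =
    (blochEntropy ((2 * b) ^ 2) + blochEntropy ((2 * c) ^ 2)) / Real.log 2 / 2 + 1 := by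
  have h₁ := ent2_add_ent2 (2 * b)
  have h₂ := ent2_add_ent2 (2 * c)
  simp only [H4, Fin.sum_univ_four, pk_qubit]
  norm_num [Complex.I_pow_three, ← sub_eq_add_neg]
  linear_combination h₁ + h₂

lemma mixed_qubit (q p b c : ℝ) :
    q • (Xg * qubit p b c * Xgᴴ) + (1 - q) • (Zg * qubit p b c * Zgᴴ) =
      qubit (q * (1 - p) + (1 - q) * p) ((2 * q - 1) * b) (-c) := by
  have hX : Xgᴴ = Xg := by
    ext i j
    fin_cases i <;> fin_cases j <;> simp [Xg]
  have hZ : Zgᴴ = Zg := by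
    ext i j
    fin_cases i <;> fin_cases j <;> simp [Zg]
  rw [hX, hZ]
  ext i j
  fin_cases i <;> fin_cases j <;> simp [Xg, Zg, qubit] <;> ring

theorem stmt19 (q : ℝ) (hq : q ∈ Set.Icc (0 : ℝ) 1)
    (ρ : Matrix (Fin 2) (Fin 2) ℂ) (hρ : IsDensity2 ρ) :
    H4 (q • (Xg * ρ * Xgᴴ) + (1 - q) • (Zg * ρ * Zgᴴ)) -
        Sent (q • (Xg * ρ * Xgᴴ) + (1 - q) • (Zg * ρ * Zgᴴ)) ≤
      H4 ρ - Sent ρ := by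
  obtain ⟨p, b, c, rfl⟩ := hρ.exists_eq_qubit
  have hdet := hρ.1.det_nonneg
  rw [det_qubit, Complex.zero_le_real] at hdet
  have ha : (2 * q - 1) ^ 2 ≤ 1 := by nlinarith [hq.1, hq.2]
  rw [mixed_qubit, H4_qubit, H4_qubit, Sent_qubit, Sent_qubit]
  set a := 2 * q - 1 with ha_def
  have hz : 2 * (q * (1 - p) + (1 - q) * p) - 1 = -a * (2 * p - 1) := by
    rw [ha_def]
    ring
  rw [hz]
  have ha₀ := sq_nonneg a
  have hx₀ := sq_nonneg (2 * b)
  have hy₀ := sq_nonneg (2 * c)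
  have hz₀ := sq_nonneg (2 * p - 1)
  have hR : (2 * p - 1) ^ 2 + (2 * b) ^ 2 + (2 * c) ^ 2 ≤ 1 := by linarith
  rw [show (2 * (a * b)) ^ 2 = a ^ 2 * (2 * b) ^ 2 by ring,
    show (-a * (2 * p - 1)) ^ 2 = a ^ 2 * (2 * p - 1) ^ 2 by ring,
    show (2 * -c) ^ 2 = (2 * c) ^ 2 by ring]
  generalize (2 * b) ^ 2 = x at *
  generalize (2 * c) ^ 2 = y at *
  generalize (2 * p - 1) ^ 2 = z at *
  generalize a ^ 2 = A at *
  have hAx := mul_nonneg ha₀ hx₀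
  have hAz := mul_nonneg ha₀ hz₀
  have hAx' := mul_nonneg (sub_nonneg.2 ha) hx₀
  have hAz' := mul_nonneg (sub_nonneg.2 ha) hz₀
  have h₁ := concaveOn_blochEntropy.sub_le_sub_of_add (a := A * x) (b := z + A * x + y)
    (d := (1 - A) * x) ⟨by linarith, by linarith⟩ ⟨by linarith, by linarith⟩ (by linarith) hAx'
  rw [show A * x + (1 - A) * x = x by ring,
    show z + A * x + y + (1 - A) * x = z + x + y by ring] at h₁
  have h₂ := antitoneOn_blochEntropy (a := A * (z + x) + y) (b := z + A * x + y)
    ⟨by linarith, by linarith⟩ ⟨by linarith, by linarith⟩ (by linarith)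
  have h₃ := antitoneOn_blochEntropy (a := A * x) (b := x)
    ⟨by linarith, by linarith⟩ ⟨by linarith, by linarith⟩ (by linarith)
  have hlog : 0 < Real.log 2 := Real.log_pos one_lt_two
  field_simp
  linarith
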